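/- arXiv:2412.18462 — 2 statements merged into one kernel-verified Lean document; each statement's English description precedes it below -/
import Mathlib

section
/- Let w : D²(1) → ℝ be a nonnegative C² function on the open unit disk such that Δw ≥ −w² on D²(1), where Δ denotes the Laplacian. If w is Lebesgue integrable on D²(1) and ∫_{D²(1)} w dA < π/8, then w(0) ≤ (8/π)·∫_{D²(1)} w dA. -/
open MeasureTheory Real

/-- The Laplacian of a function `w : ℂ → ℝ`, computed as the sum of the second
directional derivatives in the directions `1` and `i` (i.e. `∂²w/∂x² + ∂²w/∂y²`). -/
noncomputable def lap (w : ℂ → ℝ) (z : ℂ) : ℝ :=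
  fderiv ℝ (fun y => fderiv ℝ w y 1) z 1 +
    fderiv ℝ (fun y => fderiv ℝ w y Complex.I) z Complex.I

noncomputable def eC (x : ℝ × ℝ) : ℂ := Complex.exp (x.2 * Complex.I)

noncomputable def pC (a : ℂ) (x : ℝ × ℝ) : ℂ := a + (x.1 : ℝ) • eC x

lemma eC_hasFDerivAt (x : ℝ × ℝ) :
    HasFDerivAt eC ((ContinuousLinearMap.snd ℝ ℝ ℝ).smulRight (eC x * Complex.I)) x := by
  have h1 : HasDerivAt (fun t : ℝ => Complex.exp (t * Complex.I))
      (eC x * Complex.I) x.2 := by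
    have : HasDerivAt (fun t : ℝ => (t : ℂ) * Complex.I) (1 * Complex.I) x.2 :=
      (Complex.ofRealCLM.hasDerivAt (x := x.2)).mul_const _
    simpa [eC] using this.cexp
  have h2 := h1.hasFDerivAt.comp x (hasFDerivAt_snd (𝕜 := ℝ) (p := x))
  refine h2.congr_fderiv ?_
  ext <;> simp

lemma pC_hasFDerivAt (a : ℂ) (x : ℝ × ℝ) :
    HasFDerivAt (pC a) ((ContinuousLinearMap.fst ℝ ℝ ℝ).smulRight (eC x) +
      (ContinuousLinearMap.snd ℝ ℝ ℝ).smulRight (x.1 • (eC x * Complex.I))) x := by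
  have h := ((hasFDerivAt_fst (𝕜 := ℝ) (p := x)).smul (eC_hasFDerivAt x)).const_add a
  refine h.congr_fderiv ?_
  ext <;> simp

lemma eC_cont : Continuous eC := by unfold eC; fun_prop

lemma pC_cont (a : ℂ) : Continuous (pC a) := by
  have := eC_cont
  unfold pC; fun_prop

lemma eC_norm (x : ℝ × ℝ) : ‖eC x‖ = 1 := by
  simp [eC, Complex.norm_exp_ofReal_mul_I]

lemma pC_mem (a : ℂ) {R : ℝ} {x : ℝ × ℝ} (h0 : 0 ≤ x.1) (h : x.1 ≤ R) :
    pC a x ∈ Metric.closedBall a R := by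
  simp [pC, eC_norm, abs_of_nonneg h0, h]

lemma eC_pi (r : ℝ) : eC (r, π) = eC (r, -π) := by
  simp only [eC, Complex.ofReal_neg, neg_mul, Complex.exp_neg, Complex.exp_pi_mul_I]
  norm_num

lemma iter_intervalIntegrable (F : ℝ × ℝ → ℝ) {R : ℝ} (hR : 0 ≤ R)
    (hF : ContinuousOn F (Set.Icc 0 R ×ˢ Set.Icc (-π) π)) :
    IntervalIntegrable (fun r => ∫ θ in (-π)..π, F (r, θ)) volume 0 R := by
  have hpi : -π ≤ π := by linarith [pi_pos]
  have h1 : IntegrableOn F (Set.Icc 0 R ×ˢ Set.Icc (-π) π) :=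
    hF.integrableOn_compact (isCompact_Icc.prod isCompact_Icc)
  have h2 : IntegrableOn F (Set.Ioc 0 R ×ˢ Set.Ioc (-π) π) :=
    h1.mono_set (Set.prod_mono Set.Ioc_subset_Icc_self Set.Ioc_subset_Icc_self)
  rw [IntegrableOn, Measure.volume_eq_prod, ← Measure.prod_restrict] at h2
  rw [intervalIntegrable_iff_integrableOn_Ioc_of_le hR]
  have h3 := h2.integral_prod_left
  simp_rw [intervalIntegral.integral_of_le hpi]
  exact h3

lemma slice_intervalIntegrable (F : ℝ × ℝ → ℝ) {R r : ℝ} (hr : r ∈ Set.Icc 0 R)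
    (hF : ContinuousOn F (Set.Icc 0 R ×ˢ Set.Icc (-π) π)) :
    IntervalIntegrable (fun θ => F (r, θ)) volume (-π) π := by
  have hpi : -π ≤ π := by linarith [pi_pos]
  apply ContinuousOn.intervalIntegrable
  rw [Set.uIcc_of_le hpi]
  exact hF.comp (by fun_prop) (fun θ hθ => ⟨hr, hθ⟩)

lemma L_cont (w : ℂ → ℝ) (U : Set ℂ) (hU : IsOpen U) (hw : ContDiffOn ℝ 2 w U) : ContDiffOn ℝ 1 (fderiv ℝ w) U :=
  hw.fderiv_of_isOpen hU (by norm_num)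

lemma L_diff (w : ℂ → ℝ) (U : Set ℂ) (hU : IsOpen U) (hw : ContDiffOn ℝ 2 w U) {z : ℂ} (hz : z ∈ U) :
    HasFDerivAt (fderiv ℝ w) (fderiv ℝ (fderiv ℝ w) z) z :=
  (((L_cont w U hU hw).differentiableOn (by norm_num)).differentiableAt
    (hU.mem_nhds hz)).hasFDerivAt

lemma LL_cont (w : ℂ → ℝ) (U : Set ℂ) (hU : IsOpen U) (hw : ContDiffOn ℝ 2 w U) : ContinuousOn (fderiv ℝ (fderiv ℝ w)) U :=
  (L_cont w U hU hw).continuousOn_fderiv_of_isOpen hU (by norm_num)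

lemma lap_eq (w : ℂ → ℝ) (U : Set ℂ) (hU : IsOpen U) (hw : ContDiffOn ℝ 2 w U) {z : ℂ} (hz : z ∈ U) (x : ℝ × ℝ) :
    fderiv ℝ (fderiv ℝ w) z (eC x) (eC x) +
      fderiv ℝ (fderiv ℝ w) z (eC x * Complex.I) (eC x * Complex.I) = lap w z := by
  have h := L_diff w U hU hw hz
  have h1 : ∀ v : ℂ, fderiv ℝ (fun y => fderiv ℝ w y v) z v =
      fderiv ℝ (fderiv ℝ w) z v v := by
    intro v
    have := (h.clm_apply (hasFDerivAt_const v z)).fderiv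
    rw [this]; simp
  have he : eC x = (Real.cos x.2) • (1 : ℂ) + (Real.sin x.2) • Complex.I := by
    simp [eC, Complex.exp_mul_I]
  have he' : eC x * Complex.I = (-Real.sin x.2) • (1 : ℂ) + (Real.cos x.2) • Complex.I := by
    rw [he]; apply Complex.ext <;> simp
  rw [lap, h1, h1, he', he]
  simp only [map_add, map_smul, add_apply, smul_apply,
    smul_eq_mul]
  linear_combination (fderiv ℝ (fderiv ℝ w) z 1 1 +
    fderiv ℝ (fderiv ℝ w) z Complex.I Complex.I) * Real.sin_sq_add_cos_sq x.2

/-- flux bound -/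
lemma flux_bound (w : ℂ → ℝ) (U : Set ℂ) (hU : IsOpen U) (hw : ContDiffOn ℝ 2 w U) (a : ℂ)
    {R K : ℝ} (hR : 0 ≤ R) (hsub : Metric.closedBall a R ⊆ U)
    (hK : ∀ z ∈ Metric.closedBall a R, -K ≤ lap w z) :
    -(K * π * R ^ 2) ≤ R * ∫ θ in (-π)..π, fderiv ℝ w (pC a (R, θ)) (eC (R, θ)) := by
  have hpi : -π ≤ π := by linarith [pi_pos]
  let E := eC
  let P := pC a
  let L := fderiv ℝ w
  let S : Set (ℝ × ℝ) := Set.Icc 0 R ×ˢ Set.Icc (-π) π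
  have hPS : Set.MapsTo P S U := fun x hx => hsub (pC_mem a hx.1.1 hx.1.2)
  have hPc : ContinuousOn P S := (pC_cont a).continuousOn
  have hEc : ContinuousOn E S := eC_cont.continuousOn
  have hLP : ContinuousOn (fun x => L (P x)) S :=
    ((L_cont w U hU hw).continuousOn).comp hPc hPS
  have hLLP : ContinuousOn (fun x => fderiv ℝ L (P x)) S :=
    (LL_cont w U hU hw).comp hPc hPS
  let f : ℝ × ℝ → ℝ := fun x => x.1 * L (P x) (E x)
  let g : ℝ × ℝ → ℝ := fun x => L (P x) (E x * Complex.I)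
  have hfc : ContinuousOn f S := continuousOn_fst.mul (hLP.clm_apply hEc)
  have hgc : ContinuousOn g S := hLP.clm_apply (hEc.mul continuousOn_const)
  have hLd : ∀ x ∈ S, HasFDerivAt (fun x => L (P x)) _ x := fun x hx =>
    (L_diff w U hU hw (hPS hx)).comp x (pC_hasFDerivAt a x)
  have hEId : ∀ x, HasFDerivAt (fun x => E x * Complex.I) _ x := fun x =>
    (eC_hasFDerivAt x).mul_const Complex.I
  have hfd : ∀ x ∈ S, DifferentiableAt ℝ f x ∧ fderiv ℝ f x (1, 0) =
      L (P x) (E x) + x.1 * fderiv ℝ L (P x) (E x) (E x) := by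
    intro x hx
    have h := (hasFDerivAt_fst (𝕜 := ℝ) (p := x)).mul ((hLd x hx).clm_apply (eC_hasFDerivAt x))
    refine ⟨h.differentiableAt, ?_⟩
    have h' : fderiv ℝ f x = _ := h.fderiv
    rw [h']
    simp [E, P, L]
    ring
  have hgd : ∀ x ∈ S, DifferentiableAt ℝ g x ∧ fderiv ℝ g x (0, 1) =
      - L (P x) (E x) +
        x.1 * fderiv ℝ L (P x) (E x * Complex.I) (E x * Complex.I) := by
    intro x hx
    have h := (hLd x hx).clm_apply (hEId x)
    refine ⟨h.differentiableAt, ?_⟩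
    have h' : fderiv ℝ g x = _ := h.fderiv
    have hI : eC x * Complex.I * Complex.I = - eC x := by
      rw [mul_assoc, Complex.I_mul_I]; ring
    rw [h']
    have hI2 : Complex.I * (eC x * Complex.I) = - eC x := by
      rw [← hI]; ring
    simp only [E, P, L, add_apply,
      ContinuousLinearMap.comp_apply, ContinuousLinearMap.flip_apply, smul_apply,
      ContinuousLinearMap.smulRight_apply,
      ContinuousLinearMap.coe_fst', ContinuousLinearMap.coe_snd', one_smul, zero_smul, zero_add,
      smul_eq_mul, hI2, map_neg, map_smul]
  let D : ℝ × ℝ → ℝ := fun x => x.1 * (fderiv ℝ L (P x) (E x) (E x) +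
    fderiv ℝ L (P x) (E x * Complex.I) (E x * Complex.I))
  have hDeq : ∀ x ∈ S, fderiv ℝ f x (1, 0) + fderiv ℝ g x (0, 1) = D x := by
    intro x hx
    rw [(hfd x hx).2, (hgd x hx).2]; simp only [D]; ring
  have hDlap : ∀ x ∈ S, D x = x.1 * lap w (P x) := by
    intro x hx
    simp only [D, E, L, P]
    rw [lap_eq w U hU hw (hPS hx)]
  have hDc : ContinuousOn D S := by
    refine continuousOn_fst.mul (ContinuousOn.add ?_ ?_)
    · exact (hLLP.clm_apply hEc).clm_apply hEc
    · have := hEc.mul (continuousOn_const (c := Complex.I))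
      exact (hLLP.clm_apply this).clm_apply this
  have hS : (Set.uIcc 0 R ×ˢ Set.uIcc (-π) π) = S := by
    rw [Set.uIcc_of_le hR, Set.uIcc_of_le hpi]
  have hsubS : (Set.Ioo (min 0 R) (max 0 R) ×ˢ Set.Ioo (min (-π) π) (max (-π) π)) ⊆ S := by
    rw [min_eq_left hR, max_eq_right hR, min_eq_left hpi, max_eq_right hpi]
    exact Set.prod_mono Set.Ioo_subset_Icc_self Set.Ioo_subset_Icc_self
  have hDi : IntegrableOn D S := hDc.integrableOn_compact (isCompact_Icc.prod isCompact_Icc)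
  have key := integral2_divergence_prod_of_hasFDerivAt f g (fderiv ℝ f) (fderiv ℝ g)
    0 (-π) R π (by rwa [hS]) (by rwa [hS])
    (fun x hx => (hfd x (hsubS hx)).1.hasFDerivAt)
    (fun x hx => (hgd x (hsubS hx)).1.hasFDerivAt)
    (by
      rw [hS]
      exact hDi.congr_fun (fun x hx => (hDeq x hx).symm) (measurableSet_Icc.prod measurableSet_Icc))
  have hg0 : ∀ r, g (r, π) = g (r, -π) := by
    intro r; simp only [g, P, E, pC, eC_pi]
  have hf0 : ∀ θ, f (0, θ) = 0 := by intro θ; simp [f]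
  simp only [hg0, hf0, sub_self, zero_add, intervalIntegral.integral_zero, sub_zero] at key
  have hfR : ∫ θ in (-π)..π, f (R, θ) =
      R * ∫ θ in (-π)..π, fderiv ℝ w (pC a (R, θ)) (eC (R, θ)) := by
    simp only [f]; rw [intervalIntegral.integral_const_mul]
  rw [← hfR, ← key]
  have hlhs : (∫ x in (0:ℝ)..R, ∫ y in (-π)..π,
      fderiv ℝ f (x, y) (1, 0) + fderiv ℝ g (x, y) (0, 1)) =
      ∫ x in (0:ℝ)..R, ∫ y in (-π)..π, D (x, y) := by
    apply intervalIntegral.integral_congr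
    intro x hx
    apply intervalIntegral.integral_congr
    intro y hy
    exact hDeq (x, y) (by rw [← hS]; exact ⟨hx, hy⟩)
  rw [hlhs]
  have hlow : ∀ r ∈ Set.Icc 0 R, (-(2 * π * K)) * r ≤ ∫ θ in (-π)..π, D (r, θ) := by
    intro r hr
    have : ∫ θ in (-π)..π, (-(r * K)) ≤ ∫ θ in (-π)..π, D (r, θ) := by
      apply intervalIntegral.integral_mono_on hpi (by simp) (slice_intervalIntegrable D hr hDc)
      intro θ hθ
      have hm : ((r, θ) : ℝ × ℝ) ∈ S := ⟨hr, hθ⟩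
      rw [hDlap _ hm]
      have := mul_le_mul_of_nonneg_left (hK (P (r, θ)) (pC_mem a hr.1 hr.2)) hr.1
      simp only; linarith
    rw [intervalIntegral.integral_const, smul_eq_mul] at this
    linarith
  have := intervalIntegral.integral_mono_on hR
    (by apply Continuous.intervalIntegrable; fun_prop) (iter_intervalIntegrable D hR hDc) hlow
  rw [intervalIntegral.integral_const_mul, integral_id] at this
  linarith

lemma circle_bound (w : ℂ → ℝ) (U : Set ℂ) (hU : IsOpen U) (hw : ContDiffOn ℝ 2 w U) (a : ℂ)
    {R K : ℝ} (hR : 0 ≤ R) (hsub : Metric.closedBall a R ⊆ U)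
    (hK : ∀ z ∈ Metric.closedBall a R, -K ≤ lap w z) :
    2 * π * w a - K * π * R ^ 2 / 2 ≤ ∫ θ in (-π)..π, w (pC a (R, θ)) := by
  have hpi : -π ≤ π := by linarith [pi_pos]
  let S : Set (ℝ × ℝ) := Set.Icc 0 R ×ˢ Set.Icc (-π) π
  have hPS : Set.MapsTo (pC a) S U := fun x hx => hsub (pC_mem a hx.1.1 hx.1.2)
  have hPc : ContinuousOn (pC a) S := (pC_cont a).continuousOn
  let f : ℝ × ℝ → ℝ := fun x => w (pC a x)
  let D : ℝ × ℝ → ℝ := fun x => fderiv ℝ w (pC a x) (eC x)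
  have hDc : ContinuousOn D S :=
    (((L_cont w U hU hw).continuousOn).comp hPc hPS).clm_apply eC_cont.continuousOn
  have hfc : ContinuousOn f S := hw.continuousOn.comp hPc hPS
  have hfd : ∀ x ∈ S, DifferentiableAt ℝ f x ∧ fderiv ℝ f x (1, 0) = D x := by
    intro x hx
    have hwd : HasFDerivAt w (fderiv ℝ w (pC a x)) (pC a x) :=
      ((hw.differentiableOn (by norm_num)).differentiableAt (hU.mem_nhds (hPS hx))).hasFDerivAt
    have h := hwd.comp x (pC_hasFDerivAt a x)
    refine ⟨h.differentiableAt, ?_⟩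
    have h' : fderiv ℝ f x = _ := h.fderiv
    rw [h']
    simp [D]
  have hS : (Set.uIcc 0 R ×ˢ Set.uIcc (-π) π) = S := by
    rw [Set.uIcc_of_le hR, Set.uIcc_of_le hpi]
  have hsubS : (Set.Ioo (min 0 R) (max 0 R) ×ˢ Set.Ioo (min (-π) π) (max (-π) π)) ⊆ S := by
    rw [min_eq_left hR, max_eq_right hR, min_eq_left hpi, max_eq_right hpi]
    exact Set.prod_mono Set.Ioo_subset_Icc_self Set.Ioo_subset_Icc_self
  have hDi : IntegrableOn D S := hDc.integrableOn_compact (isCompact_Icc.prod isCompact_Icc)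
  have key := integral2_divergence_prod_of_hasFDerivAt f (fun _ => 0) (fderiv ℝ f) (fun _ => 0)
    0 (-π) R π (by rwa [hS]) continuousOn_const
    (fun x hx => (hfd x (hsubS hx)).1.hasFDerivAt)
    (fun x hx => hasFDerivAt_const _ _)
    (by
      rw [hS]
      exact hDi.congr_fun (fun x hx => by simp [(hfd x hx).2])
        (measurableSet_Icc.prod measurableSet_Icc))
  have hf0 : ∀ θ, f (0, θ) = w a := by intro θ; simp [f, pC]
  have hlhs : (∫ x in (0:ℝ)..R, ∫ y in (-π)..π,
      fderiv ℝ f (x, y) (1, 0) + (0 : ℝ × ℝ →L[ℝ] ℝ) (0, 1)) =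
      ∫ x in (0:ℝ)..R, ∫ y in (-π)..π, D (x, y) := by
    apply intervalIntegral.integral_congr
    intro x hx
    apply intervalIntegral.integral_congr
    intro y hy
    have := (hfd (x, y) (by rw [← hS]; exact ⟨hx, hy⟩)).2
    simp [this]
  rw [hlhs] at key
  simp only [hf0, intervalIntegral.integral_zero, sub_self, zero_add,
    intervalIntegral.integral_const, smul_eq_mul] at key
  have hlow : ∀ r ∈ Set.Ioo 0 R, (-(π * K)) * r ≤ ∫ θ in (-π)..π, D (r, θ) := by
    intro r hr
    have hcb := Metric.closedBall_subset_closedBall (x := a) hr.2.le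
    have h := flux_bound w U hU hw a hr.1.le (hcb.trans hsub) (fun z hz => hK z (hcb hz))
    refine le_of_mul_le_mul_left ?_ hr.1
    calc r * (-(π * K) * r) = -(K * π * r ^ 2) := by ring
      _ ≤ _ := h
  have := intervalIntegral.integral_mono_on_of_le_Ioo hR
    (by apply Continuous.intervalIntegrable; fun_prop) (iter_intervalIntegrable D hR hDc) hlow
  rw [intervalIntegral.integral_const_mul, integral_id, key] at this
  simp only [f] at this
  linarith

lemma disk_bound (w : ℂ → ℝ) (U : Set ℂ) (hU : IsOpen U) (hw : ContDiffOn ℝ 2 w U) (a : ℂ)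
    {R K : ℝ} (hR : 0 ≤ R) (hsub : Metric.closedBall a R ⊆ U)
    (hK : ∀ z ∈ Metric.closedBall a R, -K ≤ lap w z) :
    π * R ^ 2 * w a - K * π * R ^ 4 / 8 ≤ ∫ z in Metric.ball a R, w z := by
  have hpi : -π ≤ π := by linarith [pi_pos]
  let S : Set (ℝ × ℝ) := Set.Icc 0 R ×ˢ Set.Icc (-π) π
  have hPS : Set.MapsTo (pC a) S U := fun x hx => hsub (pC_mem a hx.1.1 hx.1.2)
  let F : ℝ × ℝ → ℝ := fun x => x.1 * w (pC a x)
  have hFc : ContinuousOn F S :=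
    continuousOn_fst.mul (hw.continuousOn.comp (pC_cont a).continuousOn hPS)
  have hpol : ∫ z in Metric.ball a R, w z =
      ∫ r in (0:ℝ)..R, ∫ θ in (-π)..π, F (r, θ) := by
    rw [← integral_indicator Metric.isOpen_ball.measurableSet,
      ← integral_add_left_eq_self _ a, ← Complex.integral_comp_polarCoord_symm]
    have hcongr : ∀ p ∈ polarCoord.target, p.1 • (Metric.ball a R).indicator w
        (a + Complex.polarCoord.symm p) =
        (Set.Ioo 0 R ×ˢ Set.Ioo (-π) π).indicator F p := by
      intro p hp
      have hp' : 0 < p.1 ∧ p.2 ∈ Set.Ioo (-π) π := hp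
      have hpe : a + Complex.polarCoord.symm p = pC a p := by
        simp [pC, eC, Complex.exp_mul_I]
        ring
      rw [hpe]
      by_cases h : p.1 < R
      · rw [Set.indicator_of_mem, Set.indicator_of_mem]
        · rfl
        · exact ⟨⟨hp'.1, h⟩, hp'.2⟩
        · simp [pC, eC_norm, abs_of_pos hp'.1, h]
      · rw [Set.indicator_of_notMem, Set.indicator_of_notMem]
        · simp
        · exact fun hh => h hh.1.2
        · simpa [pC, norm_smul, eC_norm, abs_of_pos hp'.1] using h
    rw [setIntegral_congr_fun (polarCoord.open_target.measurableSet) hcongr,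
      setIntegral_indicator (measurableSet_Ioo.prod measurableSet_Ioo)]
    have hset : polarCoord.target ∩ (Set.Ioo 0 R ×ˢ Set.Ioo (-π) π) =
        Set.Ioo 0 R ×ˢ Set.Ioo (-π) π := by
      apply Set.inter_eq_right.2
      intro p hp
      exact ⟨hp.1.1, hp.2⟩
    rw [hset, Measure.volume_eq_prod, setIntegral_prod]
    · simp_rw [intervalIntegral.integral_of_le hpi, intervalIntegral.integral_of_le hR,
        integral_Ioc_eq_integral_Ioo]
    · rw [← Measure.volume_eq_prod]
      exact (hFc.integrableOn_compact (isCompact_Icc.prod isCompact_Icc)).mono_set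
        (Set.prod_mono Set.Ioo_subset_Icc_self Set.Ioo_subset_Icc_self)
  rw [hpol]
  have hlow : ∀ r ∈ Set.Icc 0 R, (2 * π * w a) * r - (K * π / 2) * r ^ 3 ≤
      ∫ θ in (-π)..π, F (r, θ) := by
    intro r hr
    have hcb := Metric.closedBall_subset_closedBall (x := a) hr.2
    have h := circle_bound w U hU hw a hr.1 (hcb.trans hsub) (fun z hz => hK z (hcb hz))
    simp only [F]
    rw [intervalIntegral.integral_const_mul]
    have := mul_le_mul_of_nonneg_left h hr.1
    linarith
  have := intervalIntegral.integral_mono_on hR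
    (by apply Continuous.intervalIntegrable; fun_prop) (iter_intervalIntegrable F hR hFc) hlow
  rw [intervalIntegral.integral_sub (by apply Continuous.intervalIntegrable; fun_prop)
    (by apply Continuous.intervalIntegrable; fun_prop),
    intervalIntegral.integral_const_mul, intervalIntegral.integral_const_mul, integral_id,
    integral_pow] at this
  norm_num at this
  linarith

/-- Mean value inequality on the unit disk: if `w ≥ 0` is `C²` with `Δw ≥ −w²`
on `D²(1)`, is integrable, and `∫_{D²(1)} w < π/8`, then `w(0) ≤ (8/π)·∫_{D²(1)} w`. -/
theorem meanvalue_quadratic_unit (w : ℂ → ℝ)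
    (hw : ContDiffOn ℝ 2 w (Metric.ball (0 : ℂ) 1))
    (hnn : ∀ z ∈ Metric.ball (0 : ℂ) 1, 0 ≤ w z)
    (hlap : ∀ z ∈ Metric.ball (0 : ℂ) 1, -(w z) ^ 2 ≤ lap w z)
    (hint : IntegrableOn w (Metric.ball (0 : ℂ) 1))
    (hsmall : ∫ z in Metric.ball (0 : ℂ) 1, w z < π / 8) :
    w 0 ≤ (8 / π) * ∫ z in Metric.ball (0 : ℂ) 1, w z := by
  have hpi := pi_pos
  set J := ∫ z in Metric.ball (0 : ℂ) 1, w z with hJ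
  have hJ0 : 0 ≤ J := setIntegral_nonneg Metric.isOpen_ball.measurableSet hnn
  have main : ∀ r ∈ Set.Ioo (0:ℝ) 1, r ^ 2 * w 0 ≤ (8 / π) * J := by
    intro r hr
    have hcb : Metric.closedBall (0:ℂ) r ⊆ Metric.ball 0 1 :=
      Metric.closedBall_subset_ball hr.2
    obtain ⟨a, ha, hmax⟩ := (isCompact_closedBall (0:ℂ) r).exists_isMaxOn
      ⟨0, by simp [hr.1.le]⟩
      (f := fun z => (r - ‖z‖) ^ 2 * w z)
      ((by fun_prop : Continuous fun z : ℂ => (r - ‖z‖) ^ 2).continuousOn.mul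
        (hw.continuousOn.mono hcb))
    have ha' : ‖a‖ ≤ r := by simpa using ha
    have h0 : r ^ 2 * w 0 ≤ (r - ‖a‖) ^ 2 * w a := by
      have := hmax (show (0:ℂ) ∈ Metric.closedBall (0:ℂ) r by simp [hr.1.le])
      simpa using this
    have hR0 : 0 ≤ (8 / π) * J := by positivity
    obtain ⟨ε, hε⟩ : ∃ ε, ε = (r - ‖a‖) / 2 := ⟨_, rfl⟩
    obtain ⟨c, hc⟩ : ∃ c, c = w a := ⟨_, rfl⟩
    have hc0 : 0 ≤ c := hc ▸ hnn a (hcb ha)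
    have h0' : r ^ 2 * w 0 ≤ 4 * ε ^ 2 * c := by
      rw [hε, hc]; linarith
    rcases eq_or_lt_of_le ha' with he | hlt
    · have : ε = 0 := by rw [hε, he]; ring
      rw [this] at h0'; linarith
    rcases eq_or_lt_of_le hc0 with he | hcpos
    · rw [← he] at h0'; linarith
    have hεpos : 0 < ε := by rw [hε]; linarith
    have hsubr : Metric.closedBall a ε ⊆ Metric.closedBall 0 r := by
      apply Metric.closedBall_subset_closedBall'
      rw [dist_zero_right, hε]; linarith
    have hbd : ∀ z ∈ Metric.closedBall a ε, w z ≤ 4 * c := by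
      intro z hz
      have hzr := hsubr hz
      have h1 : (r - ‖z‖) ^ 2 * w z ≤ 4 * ε ^ 2 * c := by
        have := hmax hzr
        simp only [Set.mem_ofPred_eq] at this
        rw [hε, hc]; linarith
      have h2 : ‖z‖ ≤ ‖a‖ + ε := by
        have := norm_le_norm_add_norm_sub' z a
        rw [Metric.mem_closedBall, dist_eq_norm] at hz
        linarith
      have h3 : ε ≤ r - ‖z‖ := by linarith
      have h4 : ε ^ 2 ≤ (r - ‖z‖) ^ 2 := by gcongr
      have h5 := mul_le_mul_of_nonneg_right h4 (hnn z (hcb hzr))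
      have h6 : 0 < ε ^ 2 := by positivity
      refine le_of_mul_le_mul_left ?_ h6
      linarith
    have hK : ∀ z ∈ Metric.closedBall a ε, -(16 * c ^ 2) ≤ lap w z := by
      intro z hz
      have h1 := hlap z (hcb (hsubr hz))
      have h2 : w z ^ 2 ≤ (4 * c) ^ 2 := by
        have := hnn z (hcb (hsubr hz))
        have := hbd z hz
        gcongr
      linarith
    have hmean : ∀ ρ, 0 ≤ ρ → ρ ≤ ε → π * ρ ^ 2 * c - 2 * c ^ 2 * π * ρ ^ 4 ≤ J := by
      intro ρ hρ0 hρ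
      have hcb2 := Metric.closedBall_subset_closedBall (x := a) hρ
      have h := disk_bound w _ Metric.isOpen_ball hw a hρ0 ((hcb2.trans hsubr).trans hcb)
        (fun z hz => hK z (hcb2 hz))
      have h2 : ∫ z in Metric.ball a ρ, w z ≤ J := by
        apply setIntegral_mono_set hint
        · filter_upwards [ae_restrict_mem Metric.isOpen_ball.measurableSet] with z hz
          exact hnn z hz
        · exact (Metric.ball_subset_closedBall.trans ((hcb2.trans hsubr).trans hcb)).eventuallyLE
      rw [← hc] at h
      linarith
    have hgoal : 4 * ε ^ 2 * c ≤ 8 / π * J := by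
      by_cases h4 : 4 * c * ε ^ 2 ≤ 1
      · have h := hmean ε hεpos.le le_rfl
        have h5 : 2 * c ^ 2 * π * ε ^ 4 ≤ π * ε ^ 2 * c / 2 := by
          have := mul_le_mul_of_nonneg_left h4 (show 0 ≤ π * ε ^ 2 * c / 2 by positivity)
          linarith
        rw [div_mul_eq_mul_div, le_div_iff₀ hpi]
        linarith
      · exfalso
        push Not at h4
        have hs := Real.sq_sqrt hc0
        have hspos := Real.sqrt_pos.2 hcpos
        have hρ2 : (1 / (2 * √c)) ^ 2 = 1 / (4 * c) := by
          rw [div_pow, mul_pow, hs]; norm_num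
        have h := hmean (1 / (2 * √c)) (by positivity) (by
          refine (sq_le_sq₀ (by positivity) hεpos.le).1 ?_
          rw [hρ2, div_le_iff₀ (by positivity)]
          linarith)
        have hρ4 : (1 / (2 * √c)) ^ 4 = (1 / (4 * c)) ^ 2 := by
          rw [← hρ2]; ring
        rw [hρ2, hρ4] at h
        have : π * (1 / (4 * c)) * c - 2 * c ^ 2 * π * (1 / (4 * c)) ^ 2 = π / 8 := by
          field_simp; norm_num
        linarith
    linarith
  have hlim : Filter.Tendsto (fun r : ℝ => r ^ 2 * w 0) (nhdsWithin 1 (Set.Iio 1))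
      (nhds (1 ^ 2 * w 0)) :=
    (by fun_prop : Continuous fun r : ℝ => r ^ 2 * w 0).continuousAt.tendsto.mono_left
      nhdsWithin_le_nhds
  have := le_of_tendsto hlim (by
    filter_upwards [Ioo_mem_nhdsLT (show (0:ℝ) < 1 by norm_num)] with r hr using main r hr)
  simpa using this
end

section
/- Monotonicity for holomorphic disks in ℂⁿ: let r > 0 and let u be a continuous map from the closed unit disk in ℂ to ℂⁿ which is holomorphic on the open unit disk D (each coordinate function is complex differentiable), satisfies u(0) = 0, and whose boundary values avoid the ball of capacity r, i.e., π·Σ_{k=1}^n |u_k(z)|² ≥ r for all z with |z| = 1. Then ∫_{{z ∈ D : π·Σ_k |u_k(z)|² < r}} Σ_{k=1}^n |u_k'(z)|² dA(z) ≥ r, i.e., the symplectic area of the part of the holomorphic disk lying inside B^{2n}(r) is at least r. -/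
open MeasureTheory Real

/-- Wirtinger C¹ functions on `U` -/
structure CW (U : Set ℂ) (F A B : ℂ → ℂ) : Prop where
  d : ∀ z ∈ U, HasFDerivAt F (A z • (ContinuousLinearMap.id ℝ ℂ) + B z • (Complex.conjCLE : ℂ →L[ℝ] ℂ)) z
  ca : ContinuousOn A U
  cb : ContinuousOn B U

namespace CW
variable {U : Set ℂ} {F A B G C D : ℂ → ℂ}

lemma cont (h : CW U F A B) : ContinuousOn F U :=
  fun z hz => (h.d z hz).continuousAt.continuousWithinAt

lemma congr (h : CW U F A B) (e : ∀ z, G z = F z) : CW U G A B := by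
  have : G = F := funext e
  exact this ▸ h

lemma congr3 (h : CW U F A B) (e : ∀ z, G z = F z) (eA : ∀ z ∈ U, C z = A z)
    (eB : ∀ z ∈ U, D z = B z) : CW U G C D := by
  have : G = F := funext e
  subst this
  exact ⟨fun z hz => by rw [eA z hz, eB z hz]; exact h.d z hz, h.ca.congr eA, h.cb.congr eB⟩

lemma congrB (h : CW U F A B) (e : ∀ z ∈ U, D z = B z) : CW U F A D :=
  ⟨fun z hz => by rw [e z hz]; exact h.d z hz, h.ca, h.cb.congr e⟩

lemma add (h : CW U F A B) (k : CW U G C D) :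
    CW U (fun z => F z + G z) (fun z => A z + C z) (fun z => B z + D z) := by
  refine ⟨fun z hz => ?_, h.ca.add k.ca, h.cb.add k.cb⟩
  refine ((h.d z hz).fun_add (k.d z hz)).congr_fderiv ?_
  ext x
  simp
  ring

lemma sub (h : CW U F A B) (k : CW U G C D) :
    CW U (fun z => F z - G z) (fun z => A z - C z) (fun z => B z - D z) := by
  refine ⟨fun z hz => ?_, h.ca.sub k.ca, h.cb.sub k.cb⟩
  refine ((h.d z hz).fun_sub (k.d z hz)).congr_fderiv ?_
  ext x
  simp
  ring

lemma mul (h : CW U F A B) (k : CW U G C D) :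
    CW U (fun z => F z * G z) (fun z => A z * G z + F z * C z) (fun z => B z * G z + F z * D z) := by
  refine ⟨fun z hz => ?_, (h.ca.mul k.cont).add (h.cont.mul k.ca), (h.cb.mul k.cont).add (h.cont.mul k.cb)⟩
  refine ((h.d z hz).mul (k.d z hz)).congr_fderiv ?_
  ext x
  simp
  ring

lemma sum {n : ℕ} {F A B : Fin n → ℂ → ℂ} (h : ∀ k, CW U (F k) (A k) (B k)) :
    CW U (fun z => ∑ k, F k z) (fun z => ∑ k, A k z) (fun z => ∑ k, B k z) := by
  refine ⟨fun z hz => ?_, continuousOn_finsetSum _ fun k _ => (h k).ca,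
    continuousOn_finsetSum _ fun k _ => (h k).cb⟩
  refine (HasFDerivAt.fun_sum (u := Finset.univ) fun k _ => (h k).d z hz).congr_fderiv ?_
  ext x
  simp [Finset.sum_add_distrib, Finset.sum_mul]

lemma holo (hU : IsOpen U) (h : DifferentiableOn ℂ F U) : CW U F (deriv F) (fun _ => 0) := by
  refine ⟨fun z hz => ?_, (h.deriv hU).continuousOn, continuousOn_const⟩
  have := ((h.differentiableAt (hU.mem_nhds hz)).hasDerivAt.hasFDerivAt).restrictScalars ℝ
  refine this.congr_fderiv ?_
  ext x
  simp [mul_comm]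

lemma conj (h : CW U F A B) :
    CW U (fun z => starRingEnd ℂ (F z)) (fun z => starRingEnd ℂ (B z)) (fun z => starRingEnd ℂ (A z)) := by
  refine ⟨fun z hz => ?_, Complex.continuous_conj.comp_continuousOn h.cb, Complex.continuous_conj.comp_continuousOn h.ca⟩
  have := (Complex.conjCLE : ℂ →L[ℝ] ℂ).hasFDerivAt.comp z (h.d z hz)
  refine this.congr_fderiv ?_
  ext x
  simp
  ring

lemma real {f : ℂ → ℝ} {φ φ' : ℝ → ℝ} (h : CW U (fun z => (f z : ℂ)) A B)
    (hB : ∀ z ∈ U, B z = starRingEnd ℂ (A z))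
    (hφ : ∀ x, HasDerivAt φ (φ' x) x) (hc : Continuous φ') :
    CW U (fun z => (φ (f z) : ℂ)) (fun z => φ' (f z) * A z) (fun z => φ' (f z) * B z) := by
  have hf : ContinuousOn f U := by
    have := Complex.continuous_re.comp_continuousOn h.cont
    simpa [Function.comp_def] using this
  have hcc : ContinuousOn (fun z => (φ' (f z) : ℂ)) U :=
    Complex.continuous_ofReal.comp_continuousOn (hc.comp_continuousOn hf)
  refine ⟨fun z hz => ?_, hcc.mul h.ca, hcc.mul h.cb⟩
  have h1 := Complex.reCLM.hasFDerivAt.comp z (h.d z hz)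
  have he : (⇑Complex.reCLM ∘ fun z => (f z : ℂ)) = f := by ext z; simp
  rw [he] at h1
  have h2 := (hφ (f z)).comp_hasFDerivAt z h1
  have h3 := Complex.ofRealCLM.hasFDerivAt.comp z h2
  refine h3.congr_fderiv ?_
  rw [hB z hz]
  ext x
  simp
  apply Complex.ext <;> simp <;> ring

lemma ext_zero {E : Type*} [NormedAddCommGroup E] (hU : IsOpen U) {B : ℂ → E}
    (h : ContinuousOn B U) {K : Set ℂ} (hK : IsCompact K) (hKU : K ⊆ U)
    (hF : ∀ z ∈ U, z ∉ K → B z = 0) :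
    Continuous (U.indicator B) ∧ HasCompactSupport (U.indicator B) := by
  have h0 : ∀ z, z ∉ K → U.indicator B z = 0 := by
    intro z hz
    by_cases hzU : z ∈ U
    · rw [Set.indicator_of_mem hzU]; exact hF z hzU hz
    · exact Set.indicator_of_notMem hzU _
  refine ⟨continuous_iff_continuousAt.2 fun z => ?_, HasCompactSupport.intro hK h0⟩
  by_cases hzU : z ∈ U
  · refine (h.continuousAt (hU.mem_nhds hzU)).congr ?_
    filter_upwards [hU.mem_nhds hzU] with w hw
    rw [Set.indicator_of_mem hw]
  · have : z ∈ Kᶜ := fun hh => hzU (hKU hh)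
    refine (continuousAt_const (y := (0 : E))).congr ?_
    filter_upwards [hK.isClosed.isOpen_compl.mem_nhds this] with w hw
    rw [h0 w hw]

lemma ext_int {E : Type*} [NormedAddCommGroup E] (hU : IsOpen U) {B : ℂ → E}
    (h : ContinuousOn B U) {K : Set ℂ} (hK : IsCompact K) (hKU : K ⊆ U)
    (hF : ∀ z ∈ U, z ∉ K → B z = 0) : IntegrableOn B U := by
  obtain ⟨h1, h2⟩ := ext_zero hU h hK hKU hF
  exact (integrable_indicator_iff hU.measurableSet).1 (h1.integrable_of_hasCompactSupport h2)

lemma vanish (hU : IsOpen U) (h : CW U F A B) {K : Set ℂ} (hK : IsCompact K)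
    (hF : ∀ z ∈ U, z ∉ K → F z = 0) (z : ℂ) (hz : z ∈ U) (hzK : z ∉ K) : A z = 0 ∧ B z = 0 := by
  have h1 := h.d z hz
  have h2 : HasFDerivAt F (0 : ℂ →L[ℝ] ℂ) z := by
    refine (hasFDerivAt_const (0 : ℂ) z).congr_of_eventuallyEq ?_
    filter_upwards [hU.mem_nhds hz, hK.isClosed.isOpen_compl.mem_nhds hzK] with w hw hw'
    exact hF w hw hw'
  have h3 := h1.unique h2
  have e1 := congrArg (fun L : ℂ →L[ℝ] ℂ => L 1) h3
  have e2 := congrArg (fun L : ℂ →L[ℝ] ℂ => L Complex.I) h3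
  simp at e1 e2
  have e3 : (A z - B z) * Complex.I = 0 := by linear_combination e2
  have e4 : A z - B z = 0 := by simpa using e3
  constructor
  · linear_combination (e1 + e4) / 2
  · linear_combination (e1 - e4) / 2

lemma integral_zero (hU : IsOpen U) (h : CW U F A B) {K : Set ℂ} (hK : IsCompact K) (hKU : K ⊆ U)
    (hF : ∀ z ∈ U, z ∉ K → F z = 0) : ∫ z in U, B z = 0 := by
  have hv := h.vanish hU hK hF
  have iF := (integrable_indicator_iff hU.measurableSet).2 (ext_int hU h.cont hK hKU hF)
  have iA := (integrable_indicator_iff hU.measurableSet).2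
    (ext_int hU h.ca hK hKU fun z hz hz' => (hv z hz hz').1)
  have iB := (integrable_indicator_iff hU.measurableSet).2
    (ext_int hU h.cb hK hKU fun z hz hz' => (hv z hz hz').2)
  set F' := U.indicator F with hF'
  set A' := U.indicator A with hA'
  set B' := U.indicator B with hB'
  have hd : ∀ z, HasFDerivAt F' (A' z • (ContinuousLinearMap.id ℝ ℂ)
      + B' z • (Complex.conjCLE : ℂ →L[ℝ] ℂ)) z := by
    intro z
    by_cases hzU : z ∈ U
    · rw [hA', hB', Set.indicator_of_mem hzU, Set.indicator_of_mem hzU]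
      refine (h.d z hzU).congr_of_eventuallyEq ?_
      filter_upwards [hU.mem_nhds hzU] with w hw
      rw [hF', Set.indicator_of_mem hw]
    · rw [hA', hB', Set.indicator_of_notMem hzU, Set.indicator_of_notMem hzU]
      have hzK : z ∈ Kᶜ := fun hh => hzU (hKU hh)
      refine HasFDerivAt.congr_fderiv (f' := (0 : ℂ →L[ℝ] ℂ)) ?_ (by ext x; simp)
      refine (hasFDerivAt_const (0 : ℂ) z).congr_of_eventuallyEq ?_
      filter_upwards [hK.isClosed.isOpen_compl.mem_nhds hzK] with w hw
      by_cases hwU : w ∈ U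
      · rw [hF', Set.indicator_of_mem hwU]; exact hF w hwU hw
      · exact Set.indicator_of_notMem hwU _
  have key : ∀ v : ℂ, ∫ z, (A' z * v + B' z * starRingEnd ℂ v) = 0 := by
    intro v
    have iv : Integrable (fun z => A' z * v + B' z * starRingEnd ℂ v) :=
      (iA.mul_const _).add (iB.mul_const _)
    have := integral_bilinear_hasFDerivAt_right_eq_neg_left_of_integrable (μ := volume)
      (f := fun _ : ℂ => (1 : ℝ)) (f' := fun _ => 0) (g := F') (v := v)
      (B := ContinuousLinearMap.lsmul ℝ ℝ)
      (g' := fun z => A' z • (ContinuousLinearMap.id ℝ ℂ) + B' z • (Complex.conjCLE : ℂ →L[ℝ] ℂ))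
      ?_ ?_ ?_ (fun x _ => hasFDerivAt_const _ _) (fun x _ => hd x)
    · simpa using this
    · simp
    · simpa using iv
    · simpa using iF
  have k1 := key 1
  have k2 := key Complex.I
  rw [integral_add (iA.mul_const _) (iB.mul_const _), integral_mul_const, integral_mul_const] at k1 k2
  simp at k1 k2
  have e3 : ((∫ z, A' z) - ∫ z, B' z) * Complex.I = 0 := by linear_combination k2
  rw [← integral_indicator hU.measurableSet, ← hB']
  have e4 : (∫ z, A' z) - ∫ z, B' z = 0 := by simpa using e3
  linear_combination (k1 - e4) / 2
end CW

/-- regularised reciprocal -/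
noncomputable def Q (a s : ℝ) : ℝ := 1 / a - ∫ t in a..s, 1 / (max t a) ^ 2

lemma Q_cont {a : ℝ} (ha : 0 < a) : Continuous fun t : ℝ => 1 / (max t a) ^ 2 := by
  refine continuous_const.div (by fun_prop) fun t => ?_
  have : 0 < max t a := lt_max_of_lt_right ha
  positivity

lemma Q_deriv {a : ℝ} (ha : 0 < a) (s : ℝ) : HasDerivAt (Q a) (-(1 / (max s a) ^ 2)) s := by
  have := (intervalIntegral.integral_hasDerivAt_right ((Q_cont ha).intervalIntegrable a s)
    ((Q_cont ha).stronglyMeasurableAtFilter _ _) (Q_cont ha).continuousAt).const_sub (1 / a)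
  exact this

lemma Q_le {a s : ℝ} (ha : 0 < a) (h : s ≤ a) : Q a s = 2 / a - s / a ^ 2 := by
  have : ∫ t in a..s, 1 / (max t a) ^ 2 = ∫ t in a..s, 1 / a ^ 2 := by
    refine intervalIntegral.integral_congr fun t ht => ?_
    rw [Set.uIcc_of_ge h] at ht
    simp [max_eq_right ht.2]
  rw [Q, this, intervalIntegral.integral_const]
  simp
  field_simp
  ring

lemma Q_ge {a s : ℝ} (ha : 0 < a) (h : a ≤ s) : Q a s = 1 / s := by
  have : ∫ t in a..s, 1 / (max t a) ^ 2 = (-1 / s) - (-1 / a) := by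
    refine intervalIntegral.integral_eq_sub_of_hasDerivAt (f := fun t => -1 / t) (fun t ht => ?_)
      ((Q_cont ha).intervalIntegrable a s)
    rw [Set.uIcc_of_le h] at ht
    have ht0 : t ≠ 0 := by linarith [ht.1]
    have := (hasDerivAt_const t (-1 : ℝ)).div (hasDerivAt_id t) ht0
    rw [max_eq_left ht.1]
    refine this.congr_deriv ?_
    simp
  rw [Q, this]
  ring

lemma Q_lower {a : ℝ} (ha : 0 < a) (s : ℝ) : 1 / max s a ≤ Q a s := by
  rcases le_total s a with h | h
  · rw [Q_le ha h, max_eq_right h]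
    have : 2 / a - s / a ^ 2 = 1 / a + (a - s) / a ^ 2 := by field_simp; ring
    rw [this]
    have : 0 ≤ (a - s) / a ^ 2 := by apply div_nonneg <;> [linarith; positivity]
    linarith
  · rw [Q_ge ha h, max_eq_left h]

/-- the mass density of the regularised pole -/
noncomputable def Dd (a s : ℝ) : ℝ := Q a s - s / (max s a) ^ 2

lemma Dd_nonneg {a : ℝ} (ha : 0 < a) (s : ℝ) : 0 ≤ Dd a s := by
  have h1 := Q_lower ha s
  have hM : 0 < max s a := lt_max_of_lt_right ha
  have : s / (max s a) ^ 2 ≤ 1 / max s a := by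
    rw [div_le_div_iff₀ (by positivity) hM]
    nlinarith [le_max_left s a]
  unfold Dd
  linarith

lemma Dd_ge {a s : ℝ} (ha : 0 < a) (h : a ≤ s) : Dd a s = 0 := by
  rw [Dd, Q_ge ha h, max_eq_left h]
  have : s ≠ 0 := by linarith
  field_simp
  ring

lemma Dd_le {a s : ℝ} (ha : 0 < a) (h : s ≤ a) : Dd a s = 2 / a - 2 * s / a ^ 2 := by
  rw [Dd, Q_le ha h, max_eq_right h]
  ring

lemma Dd_cont {a : ℝ} (ha : 0 < a) : Continuous (Dd a) := by
  have h1 : Continuous (Q a) := continuous_iff_continuousAt.2 fun s => (Q_deriv ha s).continuousAt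
  have h2 := h1.sub (continuous_id.mul (Q_cont ha))
  refine h2.congr fun s => ?_
  simp [Dd, div_eq_mul_inv]

lemma Dd_integral {d : ℝ} (hd : 0 < d) : ∫ z : ℂ, Dd (d ^ 2) (‖z‖ ^ 2) = π := by
  rw [integral_fun_norm_addHaar volume (fun y => Dd (d ^ 2) (y ^ 2))]
  have h1 : ∫ y in Set.Ioi (0 : ℝ), y ^ (Module.finrank ℝ ℂ - 1) • Dd (d ^ 2) (y ^ 2)
      = ∫ y in Set.Ioc 0 d, (2 * y / d ^ 2 - 2 * y ^ 3 / d ^ 4) := by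
    rw [setIntegral_eq_of_subset_of_forall_sdiff_eq_zero measurableSet_Ioi
      (Set.Ioc_subset_Ioi_self : Set.Ioc 0 d ⊆ _)]
    · refine setIntegral_congr_fun measurableSet_Ioc fun y hy => ?_
      have : y ^ 2 ≤ d ^ 2 := by nlinarith [hy.1, hy.2]
      simp only [Complex.finrank_real_complex, smul_eq_mul]
      rw [Dd_le (by positivity) this]
      norm_num
      ring
    · rintro y ⟨hy, hy'⟩
      have hyd : d ≤ y := by
        by_contra hh
        exact hy' ⟨hy, by linarith⟩
      have : d ^ 2 ≤ y ^ 2 := by nlinarith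
      simp [Dd_ge (by positivity) this]
  rw [h1, ← intervalIntegral.integral_of_le hd.le,
    intervalIntegral.integral_eq_sub_of_hasDerivAt
      (f := fun y => y ^ 2 / d ^ 2 - y ^ 4 / (2 * d ^ 4)) (fun y _ => ?_)
      (Continuous.intervalIntegrable (by fun_prop) _ _)]
  · have : volume.real (Metric.ball (0 : ℂ) 1) = π := by
      simp [Measure.real, Complex.volume_ball]
    rw [this]
    simp
    field_simp
    ring
  · have := ((hasDerivAt_pow 2 y).div_const (d ^ 2)).sub ((hasDerivAt_pow 4 y).div_const (2 * d ^ 4))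
    refine (this.congr_deriv ?_)
    norm_num
    field_simp
    ring

lemma cutoffs {a b : ℝ} (ha : 0 < a) (hab : a < b) : ∃ (p χ g : ℝ → ℝ) (P : ℝ), 0 < P ∧
    Continuous p ∧ (∀ t, t ≤ a → p t = 0) ∧ (∀ t, HasDerivAt χ (-p t) t) ∧
    (∀ t, HasDerivAt g (-(p t / max t a)) t) ∧ (∀ t, 0 ≤ χ t) ∧ (∀ t, t ≤ a → χ t = P) ∧
    (∀ t, b ≤ t → χ t = 0) ∧ (∀ t, b ≤ t → g t = 0) ∧ (∀ t, t ≤ b → g t ≤ P / a) ∧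
    (∀ t, 0 ≤ g t) := by
  set p : ℝ → ℝ := fun t => max 0 ((t - a) * (b - t)) with hp
  have pc : Continuous p := by fun_prop
  have p0 : ∀ t, 0 ≤ p t := fun t => le_max_left _ _
  have pa : ∀ t, t ≤ a → p t = 0 := fun t ht => max_eq_left (by nlinarith)
  have pb : ∀ t, b ≤ t → p t = 0 := fun t ht => max_eq_left (by nlinarith)
  have M0 : ∀ t : ℝ, 0 < max t a := fun t => lt_max_of_lt_right ha
  have qc : Continuous fun t => p t / max t a := pc.div (by fun_prop) fun t => (M0 t).ne'
  have q0 : ∀ t, 0 ≤ p t / max t a := fun t => div_nonneg (p0 t) (M0 t).le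
  have zr : ∀ (w : ℝ → ℝ) (c d : ℝ), (∀ t ∈ Set.uIcc c d, w t = 0) → ∫ t in c..d, w t = 0 := by
    intro w c d h
    rw [intervalIntegral.integral_congr (g := fun _ => 0) h]; simp
  have dv : ∀ (w : ℝ → ℝ), Continuous w → ∀ t, HasDerivAt (fun t => ∫ x in t..b, w x) (-w t) t :=
    fun w hw t => intervalIntegral.integral_hasDerivAt_left (hw.intervalIntegrable _ _)
      (hw.stronglyMeasurableAtFilter _ _) hw.continuousAt
  have zb : ∀ t, b ≤ t → ∫ x in t..b, p x = 0 := fun t ht => zr _ _ _ fun x hx => by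
    rw [Set.uIcc_of_ge ht] at hx; exact pb x hx.1
  have zb' : ∀ t, b ≤ t → ∫ x in t..b, p x / max x a = 0 := fun t ht => zr _ _ _ fun x hx => by
    rw [Set.uIcc_of_ge ht] at hx; simp [pb x hx.1]
  have za : ∀ t, t ≤ a → ∫ x in t..b, p x = ∫ x in a..b, p x := fun t ht => by
    rw [← intervalIntegral.integral_add_adjacent_intervals (pc.intervalIntegrable t a)
      (pc.intervalIntegrable a b), zr p t a, zero_add]
    intro x hx
    rw [Set.uIcc_of_le ht] at hx; exact pa x hx.2
  have nn : ∀ t, 0 ≤ ∫ x in t..b, p x := by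
    intro t
    rcases le_total t b with h | h
    · exact intervalIntegral.integral_nonneg h fun x _ => p0 x
    · rw [zb t h]
  have lP : ∀ t, t ≤ b → ∫ x in t..b, p x ≤ ∫ x in a..b, p x := by
    intro t ht
    rcases le_total t a with h | h
    · rw [za t h]
    · rw [← intervalIntegral.integral_add_adjacent_intervals (pc.intervalIntegrable a t)
        (pc.intervalIntegrable t b)]
      have := intervalIntegral.integral_nonneg (μ := volume) h fun x _ => p0 x
      linarith
  refine ⟨p, fun t => ∫ x in t..b, p x, fun t => ∫ x in t..b, p x / max x a, ∫ x in a..b, p x,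
    ?_, pc, pa, dv p pc, dv _ qc, nn, za, zb, zb', ?_, ?_⟩
  · refine intervalIntegral.intervalIntegral_pos_of_pos_on (pc.intervalIntegrable a b) ?_ hab
    intro x hx
    exact lt_max_of_lt_right (mul_pos (by linarith [hx.1]) (by linarith [hx.2]))
  · intro t ht
    calc ∫ x in t..b, p x / max x a ≤ ∫ x in t..b, p x / a := by
          refine intervalIntegral.integral_mono_on ht (qc.intervalIntegrable _ _)
            ((pc.div_const a).intervalIntegrable _ _) fun x _ => ?_
          exact div_le_div_of_nonneg_left (p0 x) ha (le_max_right _ _)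
      _ = (∫ x in t..b, p x) / a := by rw [intervalIntegral.integral_div]
      _ ≤ _ := by gcongr; exact lP t ht
  · intro t
    rcases le_total t b with h | h
    · exact intervalIntegral.integral_nonneg h fun x _ => q0 x
    · exact (zb' t h).ge

/-- the (1,0)-derivative of the square norm -/
noncomputable def SS {n : ℕ} (w : Fin n → ℂ → ℂ) (z : ℂ) : ℂ :=
  ∑ k, deriv (w k) z * starRingEnd ℂ (w k z)

/-- square norm -/
noncomputable def NN {n : ℕ} (w : Fin n → ℂ → ℂ) (z : ℂ) : ℝ := ∑ k, ‖w k z‖ ^ 2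

lemma NN_nonneg {n : ℕ} (w : Fin n → ℂ → ℂ) (z : ℂ) : 0 ≤ NN w z :=
  Finset.sum_nonneg fun _ _ => by positivity

lemma NN_CW {n : ℕ} {U : Set ℂ} (hU : IsOpen U) (w : Fin n → ℂ → ℂ)
    (hw : ∀ k, DifferentiableOn ℂ (w k) U) :
    CW U (fun z => (NN w z : ℂ)) (SS w) (fun z => starRingEnd ℂ (SS w z)) := by
  refine (CW.sum fun k => (CW.holo hU (hw k)).mul (CW.holo hU (hw k)).conj).congr3 ?_ ?_ ?_
  · intro z
    simp [NN, Complex.mul_conj']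
  · intro z _
    simp [SS]
  · intro z _
    simp [SS, mul_comm]

lemma SS_CW {n : ℕ} {U : Set ℂ} (hU : IsOpen U) (w : Fin n → ℂ → ℂ)
    (hw : ∀ k, DifferentiableOn ℂ (w k) U) :
    ∃ A, CW U (SS w) A (fun z => (NN (fun k => deriv (w k)) z : ℂ)) := by
  refine ⟨_, (CW.sum fun k => (CW.holo hU ((hw k).deriv hU)).mul (CW.holo hU (hw k)).conj).congr3
    (fun z => rfl) (fun z _ => rfl) ?_⟩
  intro z _
  simp [NN, Complex.mul_conj']

lemma SS_le {n : ℕ} (w : Fin n → ℂ → ℂ) (z : ℂ) :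
    ‖SS w z‖ ^ 2 ≤ NN w z * NN (fun k => deriv (w k)) z := by
  have h1 : ‖SS w z‖ ≤ ∑ k, ‖deriv (w k) z‖ * ‖w k z‖ :=
    (norm_sum_le _ _).trans (le_of_eq (by simp))
  calc ‖SS w z‖ ^ 2 ≤ (∑ k, ‖deriv (w k) z‖ * ‖w k z‖) ^ 2 := by gcongr
    _ ≤ (∑ k, ‖deriv (w k) z‖ ^ 2) * ∑ k, ‖w k z‖ ^ 2 := Finset.sum_mul_sq_le_sq_mul_sq _ _ _
    _ = _ := mul_comm _ _

lemma zz_CW {U : Set ℂ} (hU : IsOpen U) :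
    CW U (fun z => ((‖z‖ ^ 2 : ℝ) : ℂ)) (fun z => starRingEnd ℂ z) (fun z => z) := by
  refine (NN_CW hU (fun (_ : Fin 1) z => z) fun _ => differentiableOn_id).congr3 ?_ ?_ ?_
  · intro z; simp [NN]
  · intro z _; simp [SS]
  · intro z _; simp [SS]

lemma core {n : ℕ} (u v : Fin n → ℂ → ℂ)
    (hu : ∀ k, DifferentiableOn ℂ (u k) (Metric.ball (0 : ℂ) 1))
    (hv : ∀ k, DifferentiableOn ℂ (v k) (Metric.ball (0 : ℂ) 1))
    (huv : ∀ k z, u k z = z * v k z) {a b : ℝ} (ha : 0 < a) (hab : a < b)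
    {K : Set ℂ} (hK : IsCompact K) (hKU : K ⊆ Metric.ball (0 : ℂ) 1)
    (hKb : ∀ z ∈ Metric.ball (0 : ℂ) 1, NN u z ≤ b → z ∈ K) :
    ENNReal.ofReal (a * π) ≤ ∫⁻ z in Metric.ball (0 : ℂ) 1 ∩ {z | NN u z ≤ b},
      ENNReal.ofReal (NN (fun k => deriv (u k)) z) := by
  obtain ⟨p, χ, g, P, hP, pc, pa, χd, gd, χ0, χa, χb, gb, gP, g0⟩ := cutoffs ha hab
  set U := Metric.ball (0 : ℂ) 1 with hUdef
  have hU : IsOpen U := Metric.isOpen_ball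
  have M0 : ∀ t : ℝ, 0 < max t a := fun t => lt_max_of_lt_right ha
  have hf := NN_CW hU u hu
  have hs := NN_CW hU v hv
  obtain ⟨A1, hβ⟩ := SS_CW hU u hu
  obtain ⟨A2, hα⟩ := SS_CW hU v hv
  have hzz := zz_CW hU
  have hz : CW U (fun z => z) (fun _ => 1) (fun _ => 0) :=
    (CW.holo hU differentiableOn_id).congr3 (fun z => rfl) (by simp) (by simp)
  have fcont : ContinuousOn (NN u) U := by
    have := Complex.continuous_re.comp_continuousOn hf.cont
    simpa [Function.comp_def] using this
  have ffac : ∀ z, NN u z = ‖z‖ ^ 2 * NN v z := by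
    intro z
    simp [NN, huv, mul_pow, Finset.mul_sum]
  have βfac : ∀ z ∈ U, SS u z = starRingEnd ℂ z * NN v z + ((‖z‖ ^ 2 : ℝ) : ℂ) * SS v z := by
    intro z hz
    have hd : ∀ k, deriv (u k) z = v k z + z * deriv (v k) z := by
      intro k
      have e : u k = fun z => z * v k z := funext (huv k)
      have := (hasDerivAt_id z).mul ((hv k).differentiableAt (hU.mem_nhds hz)).hasDerivAt
      rw [e]
      exact (this.deriv).trans (by simp)
    have h2 : ((‖z‖ ^ 2 : ℝ) : ℂ) = z * starRingEnd ℂ z := by rw [Complex.mul_conj']; simp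
    rw [h2]
    simp only [SS, NN, hd, huv, map_mul, Complex.ofReal_sum, Complex.ofReal_pow, Finset.mul_sum,
      ← Finset.sum_add_distrib, ← Complex.mul_conj']
    refine Finset.sum_congr rfl fun k _ => ?_
    ring
  obtain ⟨d, hd0, hd1, hda⟩ : ∃ d : ℝ, 0 < d ∧ d ≤ 1 ∧ ∀ z : ℂ, ‖z‖ < d → NN u z < a := by
    have h0U : (0 : ℂ) ∈ U := Metric.mem_ball_self one_pos
    have hc := fcont.continuousAt (hU.mem_nhds h0U)
    have h00 : NN u 0 < a := by rw [ffac]; simpa using ha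
    obtain ⟨ε, hε, h⟩ := Metric.eventually_nhds_iff.1 (hc.eventually (gt_mem_nhds h00))
    refine ⟨min ε 1, by positivity, min_le_right _ _, fun z hz => h ?_⟩
    simpa using lt_of_lt_of_le hz (min_le_left _ _)
  have hδ : 0 < d ^ 2 := by positivity
  have F1 := hf.real (fun z _ => rfl) χd pc.neg
  have F2 := hz.conj.mul (hzz.real (fun z _ => by simp) (Q_deriv hδ) (Q_cont hδ).neg)
  have F3 := (hs.real (fun z _ => rfl) (Q_deriv ha) (Q_cont ha).neg).mul hα
  have F4 := (hf.real (fun z _ => rfl) gd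
    (pc.div (by fun_prop) fun t => (M0 t).ne').neg).mul hβ
  have FF := (F1.mul (F2.add F3)).sub F4
  set N : ℂ → ℝ := fun z => Q a (NN v z) * NN (fun k => deriv (v k)) z
    - ‖SS v z‖ ^ 2 / (max (NN v z) a) ^ 2 with hN
  have N0 : ∀ z, 0 ≤ N z := by
    intro z
    have h1 := SS_le v z
    have h2 := Q_lower ha (NN v z)
    have h3 := NN_nonneg (fun k => deriv (v k)) z
    have hM := M0 (NN v z)
    have h4 : ‖SS v z‖ ^ 2 / (max (NN v z) a) ^ 2
        ≤ 1 / max (NN v z) a * NN (fun k => deriv (v k)) z := by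
      rw [div_le_iff₀ (by positivity)]
      calc _ ≤ _ := h1
        _ ≤ max (NN v z) a * NN (fun k => deriv (v k)) z := by gcongr; exact le_max_left _ _
        _ = _ := by field_simp
    have h5 := mul_le_mul_of_nonneg_right h2 h3
    simp only [hN]
    linarith
  set H : ℂ → ℝ := fun z => χ (NN u z) * (Dd (d ^ 2) (‖z‖ ^ 2) + N z) with hH
  set G : ℂ → ℝ := fun z => g (NN u z) * NN (fun k => deriv (u k)) z with hG
  have FB := FF.congrB (D := fun z => ((H z - G z : ℝ) : ℂ)) (by
    intro z hz
    have hz1 : ‖z‖ < 1 := by simpa [hUdef] using hz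
    have c1 : starRingEnd ℂ z * z = (‖z‖ : ℂ) ^ 2 := Complex.conj_mul' z
    have c2 : starRingEnd ℂ (SS v z) * SS v z = (‖SS v z‖ : ℂ) ^ 2 := Complex.conj_mul' _
    have br : (p (NN u z) : ℂ) * (starRingEnd ℂ z * (Q (d ^ 2) (‖z‖ ^ 2) : ℂ)
        + (Q a (NN v z) : ℂ) * SS v z) = ((p (NN u z) / max (NN u z) a : ℝ) : ℂ) * SS u z := by
      rcases le_total (NN u z) a with h | h
      · simp [pa _ h]
      · have hzd : d ≤ ‖z‖ := by
          by_contra hh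
          linarith [hda z (by linarith)]
        have hz0 : z ≠ 0 := by
          rintro rfl
          simp at hzd
          linarith
        have hs1 : a ≤ NN v z := by
          have := NN_nonneg v z
          have h3 := ffac z
          have : ‖z‖ ^ 2 ≤ 1 := by nlinarith [norm_nonneg z]
          nlinarith
        have hs0 : (NN v z : ℂ) ≠ 0 := by
          exact_mod_cast (by linarith : NN v z ≠ 0)
        have hn0 : (‖z‖ : ℂ) ≠ 0 := by exact_mod_cast (norm_ne_zero_iff.2 hz0)
        rw [max_eq_left h, Q_ge hδ (by gcongr), Q_ge ha hs1, βfac z hz]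
        push_cast
        rw [ffac z]
        push_cast
        field_simp
    simp only [hH, hG, hN, Dd]
    push_cast at br ⊢
    simp only [map_one]
    linear_combination (starRingEnd ℂ (SS u z)) * br
      + (χ (NN u z) : ℂ) * (1 / (max (‖z‖ ^ 2) (d ^ 2) : ℝ) ^ 2) * c1
      + (χ (NN u z) : ℂ) * (1 / (max (NN v z) a : ℝ) ^ 2) * c2)
  have hF0 : ∀ z ∈ U, z ∉ K → b ≤ NN u z := fun z hz hzK => by
    by_contra hh
    exact hzK (hKb z hz (by linarith))
  have hFv : ∀ z ∈ U, z ∉ K → _ = (0 : ℂ) := fun z hz hzK => (by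
    rw [χb _ (hF0 z hz hzK), gb _ (hF0 z hz hzK)]; simp :
      (χ (NN u z) : ℂ) * (starRingEnd ℂ z * (Q (d ^ 2) (‖z‖ ^ 2) : ℂ)
        + (Q a (NN v z) : ℂ) * SS v z) - (g (NN u z) : ℂ) * SS u z = 0)
  have int0 := FB.integral_zero hU hK hKU hFv
  have iB : IntegrableOn (fun z => H z - G z) U := by
    have := (CW.ext_int hU FB.cb hK hKU fun z hz hz' => (FB.vanish hU hK hFv z hz hz').2).re
    simp only [RCLike.re_to_complex, Complex.ofReal_re] at this
    exact this
  have iG : IntegrableOn G U := by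
    refine CW.ext_int hU ?_ hK hKU fun z hz hzK => by simp [hG, gb _ (hF0 z hz hzK)]
    have gc : Continuous g := continuous_iff_continuousAt.2 fun t => (gd t).continuousAt
    refine (gc.comp_continuousOn fcont).mul ?_
    have := Complex.continuous_re.comp_continuousOn hβ.cb
    simpa [Function.comp_def] using this
  have iH : IntegrableOn H U := by
    have := iB.add iG
    refine this.congr (Filter.Eventually.of_forall fun z => ?_)
    simp
  have eq1 : ∫ z in U, H z = ∫ z in U, G z := by
    have h1 : ∫ z in U, ((H z - G z : ℝ) : ℂ) = ((∫ z in U, (H z - G z) : ℝ) : ℂ) :=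
      integral_ofReal
    have h0 : ∫ z in U, (H z - G z) = 0 := by exact_mod_cast h1.symm.trans int0
    rw [integral_sub iH iG] at h0
    linarith
  have iD : Integrable (fun z : ℂ => P * Dd (d ^ 2) (‖z‖ ^ 2)) := by
    refine Integrable.const_mul ?_ P
    refine Integrable.of_integral_ne_zero ?_
    rw [Dd_integral hd0]
    exact pi_ne_zero
  have le1 : P * π ≤ ∫ z in U, G z := by
    rw [← eq1, ← Dd_integral hd0, ← integral_const_mul]
    rw [← setIntegral_eq_integral_of_forall_compl_eq_zero (s := U)]
    · refine setIntegral_mono_on iD.integrableOn iH hU.measurableSet fun z _ => ?_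
      simp only [hH]
      rcases lt_or_ge ‖z‖ d with h | h
      · rw [χa _ (hda z h).le]
        have := N0 z
        gcongr
        linarith
      · rw [Dd_ge hδ (by gcongr), mul_zero]
        exact mul_nonneg (χ0 _) (by linarith [N0 z])
    · intro z hz
      have : 1 ≤ ‖z‖ := by simpa [hUdef] using hz
      rw [Dd_ge hδ (by gcongr; linarith), mul_zero]
  have G0 : ∀ z, 0 ≤ G z := fun z => mul_nonneg (g0 _) (NN_nonneg _ _)
  have le2 : ENNReal.ofReal (P * π) ≤ ENNReal.ofReal (P / a) *
      ∫⁻ z in U ∩ {z | NN u z ≤ b}, ENNReal.ofReal (NN (fun k => deriv (u k)) z) := by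
    calc _ ≤ ENNReal.ofReal (∫ z in U, G z) := ENNReal.ofReal_le_ofReal le1
      _ = ∫⁻ z in U, ENNReal.ofReal (G z) :=
        ofReal_integral_eq_lintegral_ofReal iG (Filter.Eventually.of_forall G0)
      _ = ∫⁻ z in U, (U ∩ {z | NN u z < b}).indicator (fun z => ENNReal.ofReal (G z)) z := by
        refine setLIntegral_congr_fun hU.measurableSet fun z hz => ?_
        by_cases h : NN u z < b
        · simp [Set.indicator, hz, h]
        · simp [Set.indicator, hz, h, hG, gb _ (not_lt.1 h)]
      _ ≤ ∫⁻ z, (U ∩ {z | NN u z < b}).indicator (fun z => ENNReal.ofReal (G z)) z :=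
        setLIntegral_le_lintegral _ _
      _ = ∫⁻ z in U ∩ {z | NN u z < b}, ENNReal.ofReal (G z) :=
        lintegral_indicator (fcont.isOpen_inter_preimage hU isOpen_Iio).measurableSet _
      _ ≤ ∫⁻ z in U ∩ {z | NN u z < b},
          ENNReal.ofReal (P / a) * ENNReal.ofReal (NN (fun k => deriv (u k)) z) := by
        refine setLIntegral_mono' (fcont.isOpen_inter_preimage hU isOpen_Iio).measurableSet
          fun z hz => ?_
        rw [← ENNReal.ofReal_mul (by positivity)]
        refine ENNReal.ofReal_le_ofReal ?_
        exact mul_le_mul_of_nonneg_right (gP _ (le_of_lt hz.2)) (NN_nonneg _ _)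
      _ = ENNReal.ofReal (P / a) * ∫⁻ z in U ∩ {z | NN u z < b},
            ENNReal.ofReal (NN (fun k => deriv (u k)) z) :=
        lintegral_const_mul' _ _ ENNReal.ofReal_ne_top
      _ ≤ _ := by
        gcongr
        intro h
        exact le_of_lt h
  calc ENNReal.ofReal (a * π) = ENNReal.ofReal (a / P) * ENNReal.ofReal (P * π) := by
        rw [← ENNReal.ofReal_mul (by positivity)]
        congr 1
        field_simp
    _ ≤ ENNReal.ofReal (a / P) * (ENNReal.ofReal (P / a) * _) := by gcongr
    _ = _ := by
        rw [← mul_assoc, ← ENNReal.ofReal_mul (by positivity)]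
        have : a / P * (P / a) = 1 := by field_simp
        rw [this]; simp

/-- Monotonicity for holomorphic disks in `ℂⁿ`: if `u` is continuous on the closed
unit disk, holomorphic on the open unit disk, `u(0) = 0`, and its boundary values
lie outside the ball of capacity `r` (i.e. `π·Σ_k |u_k(z)|² ≥ r` for `|z| = 1`),
then the symplectic area (energy) of the part of the disk lying inside
`B^{2n}(r)` is at least `r`. -/
theorem monotonicity_holomorphic_disk (n : ℕ) (r : ℝ) (hr : 0 < r)
    (u : ℂ → EuclideanSpace ℂ (Fin n))
    (hcont : ContinuousOn u (Metric.closedBall (0 : ℂ) 1))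
    (hhol : ∀ k, DifferentiableOn ℂ (fun z => u z k) (Metric.ball (0 : ℂ) 1))
    (h0 : u 0 = 0)
    (hbdry : ∀ z : ℂ, ‖z‖ = 1 → r ≤ π * ∑ k, ‖u z k‖ ^ 2) :
    ENNReal.ofReal r ≤
      ∫⁻ z in {z : ℂ | ‖z‖ < 1 ∧ π * ∑ k, ‖u z k‖ ^ 2 < r},
        ENNReal.ofReal (∑ k, ‖deriv (fun w => u w k) z‖ ^ 2) := by
  set T := ∫⁻ z in {z : ℂ | ‖z‖ < 1 ∧ π * ∑ k, ‖u z k‖ ^ 2 < r},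
        ENNReal.ofReal (∑ k, ‖deriv (fun w => u w k) z‖ ^ 2) with hT
  have fc : ContinuousOn (fun z => ∑ k, ‖u z k‖ ^ 2) (Metric.closedBall (0 : ℂ) 1) := by
    refine (hcont.norm.pow 2).congr fun z _ => ?_
    simp [EuclideanSpace.norm_sq_eq]
  have key : ∀ c, 0 < c → c < r → ENNReal.ofReal c ≤ T := by
    intro c hc hcr
    set b := (c + r) / 2 / π with hb
    have hab : c / π < b := by rw [hb]; gcongr; linarith
    have hbr : π * b < r := by rw [hb]; field_simp; linarith
    have := core (fun k z => u z k) (fun k => dslope (fun z => u z k) 0) hhol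
      (fun k => (Complex.differentiableOn_dslope (Metric.ball_mem_nhds _ one_pos)).2 (hhol k))
      (fun k z => by
        have := sub_smul_dslope (fun z => u z k) 0 z
        simp [h0] at this
        exact this.symm) (a := c / π) (b := b) (by positivity) hab
      (K := Metric.closedBall 0 1 ∩ (fun z => ∑ k, ‖u z k‖ ^ 2) ⁻¹' Set.Iic b)
      ((isCompact_closedBall _ _).of_isClosed_subset
        (fc.preimage_isClosed_of_isClosed Metric.isClosed_closedBall isClosed_Iic)
        Set.inter_subset_left)
      (by
        rintro z ⟨hz, hz'⟩
        simp at hz hz' ⊢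
        refine lt_of_le_of_ne hz fun h => ?_
        have h1 := hbdry z h
        have h2 := mul_le_mul_of_nonneg_left hz' pi_pos.le
        linarith)
      (fun z hz h => ⟨Metric.ball_subset_closedBall hz, h⟩)
    rw [div_mul_cancel₀ _ pi_ne_zero] at this
    refine this.trans (lintegral_mono_set ?_)
    rintro z ⟨hz, hz'⟩
    refine ⟨by simpa using hz, ?_⟩
    have h2 := mul_le_mul_of_nonneg_left (show ∑ k, ‖u z k‖ ^ 2 ≤ b from hz') pi_pos.le
    linarith
  refine le_of_forall_lt fun x hx => ?_
  obtain ⟨y, hxy, hyr⟩ := exists_between hx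
  have hyt : y ≠ ⊤ := ne_top_of_lt hyr
  have hy0 : y ≠ 0 := ne_bot_of_gt hxy
  refine lt_of_lt_of_le hxy ?_
  have := key y.toReal (ENNReal.toReal_pos hy0 hyt)
    (by rw [← ENNReal.lt_ofReal_iff_toReal_lt hyt]; exact hyr)
  rwa [ENNReal.ofReal_toReal hyt] at this
end
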